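/- For all positive integers m and n, the minimum forcing number of the prism over the complete bipartite graph K_{m,n} satisfies f(K_{m,n} □ K_2) = min{m, n}. -/

import Mathlib

open SimpleGraph

noncomputable def forcingNumber {V : Type*} (G : SimpleGraph V) (M : G.Subgraph) : ℕ :=
  sInf {c | ∃ S : Set (Sym2 V), S ⊆ M.edgeSet ∧ S.ncard = c ∧
    ∀ M' : G.Subgraph, M'.IsPerfectMatching → S ⊆ M'.edgeSet → M' = M}

noncomputable def minForcingNumber {V : Type*} (G : SimpleGraph V) : ℕ :=
  sInf {c | ∃ M : G.Subgraph, M.IsPerfectMatching ∧ forcingNumber G M = c}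

/-- Perfect matchings are maximal under inclusion of edges. -/
theorem SimpleGraph.Subgraph.IsPerfectMatching.eq_of_adj_imp {V : Type*} {G : SimpleGraph V}
    {M M' : G.Subgraph} (hM : M.IsPerfectMatching) (hM' : M'.IsPerfectMatching)
    (h : ∀ x y, M.Adj x y → M'.Adj x y) : M' = M := by
  rw [Subgraph.isPerfectMatching_iff] at hM
  have hu := Subgraph.isPerfectMatching_iff.mp hM'
  have hsp : M.IsSpanning := fun v => (hM v).exists.elim fun _ hw => hw.fst_mem
  refine Subgraph.ext ?_ ?_
  · rw [Subgraph.isSpanning_iff.mp hsp, Subgraph.isSpanning_iff.mp hM'.2]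
  · ext x y
    refine ⟨fun hxy => ?_, h x y⟩
    obtain ⟨z, hz, -⟩ := hM x
    rwa [(hu x).unique hxy (h x z hz)]

/-- A forcing set of a perfect matching meets every alternating 4-cycle. -/
theorem mem_or_mem_of_alternating_cycle {V : Type*} {G : SimpleGraph V} {M : G.Subgraph}
    (hM : M.IsPerfectMatching) {S : Set (Sym2 V)} (hS : S ⊆ M.edgeSet)
    (hforce : ∀ M' : G.Subgraph, M'.IsPerfectMatching → S ⊆ M'.edgeSet → M' = M)
    {a b c d : V} (hab : M.Adj a b) (hcd : M.Adj c d) (hac : a ≠ c)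
    (hbc : G.Adj b c) (hda : G.Adj d a) : s(a, b) ∈ S ∨ s(c, d) ∈ S := by
  by_contra! hcon
  obtain ⟨h1, h2⟩ := hcon
  have hu := Subgraph.isPerfectMatching_iff.mp hM
  have uniq : ∀ {x y z}, M.Adj x y → M.Adj x z → y = z := fun h h' => (hu _).unique h h'
  have hbd : b ≠ d := fun h => hac (uniq hab.symm (h ▸ hcd.symm))
  have nab := hab.ne
  have ncd := hcd.ne
  have nbc := hbc.ne
  have nda := hda.ne
  let M' : G.Subgraph :=
    { verts := Set.univ
      Adj := fun x y => (M.Adj x y ∧ x ≠ a ∧ x ≠ b ∧ x ≠ c ∧ x ≠ d) ∨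
        (x = b ∧ y = c) ∨ (x = c ∧ y = b) ∨ (x = d ∧ y = a) ∨ (x = a ∧ y = d)
      adj_sub := by
        rintro x y (⟨h, -⟩ | ⟨rfl, rfl⟩ | ⟨rfl, rfl⟩ | ⟨rfl, rfl⟩ | ⟨rfl, rfl⟩)
        exacts [h.adj_sub, hbc, hbc.symm, hda, hda.symm]
      edge_vert := fun _ => Set.mem_univ _
      symm := ⟨by
        rintro x y (⟨h, ha, hb, hc, hd⟩ | h)
        · refine Or.inl ⟨h.symm, ?_, ?_, ?_, ?_⟩ <;> rintro rfl
          exacts [hb (uniq h.symm hab), ha (uniq h.symm hab.symm), hd (uniq h.symm hcd),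
            hc (uniq h.symm hcd.symm)]
        · tauto⟩ }
  have hM' : M'.IsPerfectMatching := by
    rw [Subgraph.isPerfectMatching_iff]
    intro v
    obtain ⟨w, hw, hw'⟩ := hu v
    simp only [M']
    by_cases va : v = a
    · exact ⟨d, by grind, by grind⟩
    by_cases vb : v = b
    · exact ⟨c, by grind, by grind⟩
    by_cases vc : v = c
    · exact ⟨b, by grind, by grind⟩
    by_cases vd : v = d
    · exact ⟨a, by grind, by grind⟩
    exact ⟨w, by grind, by grind⟩
  have hSM' : S ⊆ M'.edgeSet := by
    intro e he
    induction e with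
    | _ x y =>
      have hxy : M.Adj x y := hS he
      refine Or.inl ⟨hxy, ?_, ?_, ?_, ?_⟩ <;> rintro rfl
      · exact h1 (uniq hxy hab ▸ he)
      · exact h1 (Sym2.eq_swap ▸ uniq hxy hab.symm ▸ he)
      · exact h2 (uniq hxy hcd ▸ he)
      · exact h2 (Sym2.eq_swap ▸ uniq hxy hcd.symm ▸ he)
  have key : M.Adj b c := by
    rw [← hforce M' hM' hSM']
    exact Or.inr (Or.inl ⟨rfl, rfl⟩)
  exact hac (uniq hab.symm key)

/-- The perfect matching of a prism consisting of the edges between the two layers. -/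
def prismMatching {W : Type*} (H : SimpleGraph W) : (H □ (⊤ : SimpleGraph (Fin 2))).Subgraph where
  verts := Set.univ
  Adj x y := x.1 = y.1 ∧ x.2 ≠ y.2
  adj_sub h := boxProd_adj.mpr (Or.inr ⟨h.2, h.1⟩)
  edge_vert _ := Set.mem_univ _
  symm := ⟨fun _ _ h => ⟨h.1.symm, h.2.symm⟩⟩

theorem prismMatching_isPerfectMatching {W : Type*} (H : SimpleGraph W) :
    (prismMatching H).IsPerfectMatching := by
  rw [Subgraph.isPerfectMatching_iff]
  rintro ⟨v, t⟩
  refine ⟨(v, 1 - t), ⟨rfl, ?_⟩, ?_⟩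
  · fin_cases t <;> simp
  · rintro ⟨w, u⟩ ⟨rfl, h⟩
    simp only [Prod.mk.injEq, true_and]
    simp only at h
    omega

/-- The edges of a prism over a vertex cover of the base force the layer-to-layer matching. -/
theorem forcingNumber_prismMatching_le {W : Type*} (H : SimpleGraph W) {k : ℕ} (φ : Fin k → W)
    (hφ : Function.Injective φ)
    (hcover : ∀ v w, H.Adj v w → v ∈ Set.range φ ∨ w ∈ Set.range φ) :
    forcingNumber _ (prismMatching H) ≤ k := by
  refine Nat.sInf_le ⟨Set.range fun i => s((φ i, (0 : Fin 2)), (φ i, 1)), ?_, ?_, ?_⟩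
  · rintro _ ⟨i, rfl⟩
    exact ⟨rfl, zero_ne_one⟩
  · rw [← Set.image_univ, Set.ncard_image_of_injective, Set.ncard_univ, Nat.card_fin]
    intro i j hij
    rcases Sym2.eq_iff.mp hij with h | h
    · exact hφ (congrArg Prod.fst h.1)
    · exact absurd (congrArg Prod.snd h.1) zero_ne_one
  · intro M' hM' hS
    have hu := Subgraph.isPerfectMatching_iff.mp hM'
    have hrange : ∀ v ∈ Set.range φ, M'.Adj (v, 0) (v, 1) := by
      rintro _ ⟨i, rfl⟩
      exact hS ⟨i, rfl⟩
    have hall : ∀ v, M'.Adj (v, 0) (v, 1) := by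
      intro v
      by_cases hv : v ∈ Set.range φ
      · exact hrange v hv
      obtain ⟨⟨w, t⟩, hw, -⟩ := hu (v, 0)
      rcases boxProd_adj.mp hw.adj_sub with ⟨h, rfl⟩ | ⟨h, rfl⟩
      · have := (hu _).unique hw.symm (hrange w ((hcover v w h).resolve_left hv))
        simp at this
      · have : t = 1 := by
          have : (0 : Fin 2) ≠ t := h
          omega
        exact this ▸ hw
    refine (prismMatching_isPerfectMatching H).eq_of_adj_imp hM' ?_
    rintro ⟨v, t⟩ ⟨w, u⟩ ⟨rfl, h⟩
    simp only at h
    fin_cases t <;> fin_cases u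
    · exact absurd rfl h
    · exact hall v
    · exact (hall v).symm
    · exact absurd rfl h

theorem min_le_ncard_of_forcing {m n : ℕ}
    {M : (completeBipartiteGraph (Fin m) (Fin n) □ (⊤ : SimpleGraph (Fin 2))).Subgraph}
    (hM : M.IsPerfectMatching) {S : Set (Sym2 ((Fin m ⊕ Fin n) × Fin 2))} (hS : S ⊆ M.edgeSet)
    (hforce : ∀ M' : (completeBipartiteGraph (Fin m) (Fin n) □ (⊤ : SimpleGraph (Fin 2))).Subgraph,
      M'.IsPerfectMatching → S ⊆ M'.edgeSet → M' = M) :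
    min m n ≤ S.ncard := by
  classical
  have hu := Subgraph.isPerfectMatching_iff.mp hM
  have uniq : ∀ {x y z}, M.Adj x y → M.Adj x z → y = z := fun h h' => (hu _).unique h h'
  choose p hp using fun v => (hu v).exists
  have hpe : ∀ {v w}, M.Adj v w → p v = w := fun h => uniq (hp _) h
  have cyc {a b c d} := @mem_or_mem_of_alternating_cycle _ _ _ hM S hS hforce a b c d
  have nbrA : ∀ i t, (∃ j, M.Adj (Sum.inl i, t) (Sum.inr j, t)) ∨
      M.Adj (Sum.inl i, 0) (Sum.inl i, 1) := by
    intro i t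
    obtain ⟨⟨w, u⟩, h, -⟩ := hu (Sum.inl i, t)
    rcases boxProd_adj.mp h.adj_sub with ⟨h', rfl⟩ | ⟨h', rfl⟩
    · cases w with
      | inl w => simp at h'
      | inr j => exact Or.inl ⟨j, h⟩
    · right
      fin_cases t <;> fin_cases u <;> first | exact h | exact h.symm | exact absurd rfl h'
  have nbrB : ∀ j t, (∃ i, M.Adj (Sum.inl i, t) (Sum.inr j, t)) ∨
      M.Adj (Sum.inr j, 0) (Sum.inr j, 1) := by
    intro j t
    obtain ⟨⟨w, u⟩, h, -⟩ := hu (Sum.inr j, t)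
    rcases boxProd_adj.mp h.adj_sub with ⟨h', rfl⟩ | ⟨h', rfl⟩
    · cases w with
      | inl i => exact Or.inl ⟨i, h.symm⟩
      | inr w => simp at h'
    · right
      fin_cases t <;> fin_cases u <;> first | exact h | exact h.symm | exact absurd rfl h'
  have notVertA : ∀ {i j t}, M.Adj (Sum.inl i, t) (Sum.inr j, t) →
      ¬ M.Adj (Sum.inl i, 0) (Sum.inl i, 1) := by
    intro i j t h h'
    have : M.Adj (Sum.inl i, t) (Sum.inl i, 1 - t) := by
      fin_cases t
      exacts [h', h'.symm]
    simpa using uniq h this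
  have notVertB : ∀ {i j t}, M.Adj (Sum.inl i, t) (Sum.inr j, t) →
      ¬ M.Adj (Sum.inr j, 0) (Sum.inr j, 1) := by
    intro i j t h h'
    have : M.Adj (Sum.inr j, t) (Sum.inr j, 1 - t) := by
      fin_cases t
      exacts [h', h'.symm]
    simpa using uniq h.symm this
  let K : Finset (Fin m) := {i | ¬ M.Adj (Sum.inl i, 0) (Sum.inl i, 1)}
  let L : Finset (Fin n) := {j | ¬ M.Adj (Sum.inr j, 0) (Sum.inr j, 1)}
  have memK : ∀ {i}, i ∈ K ↔ ¬ M.Adj (Sum.inl i, 0) (Sum.inl i, 1) := by simp [K]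
  have memL : ∀ {j}, j ∈ L ↔ ¬ M.Adj (Sum.inr j, 0) (Sum.inr j, 1) := by simp [L]
  let TA : Finset (Fin m) := {i | s((Sum.inl i, 0), p (Sum.inl i, 0)) ∈ S}
  let TB : Finset (Fin n) := {j | s((Sum.inr j, 1), p (Sum.inr j, 1)) ∈ S}
  have memTA : ∀ {i}, i ∈ TA ↔ s((Sum.inl i, 0), p (Sum.inl i, 0)) ∈ S := by simp [TA]
  have memTB : ∀ {j}, j ∈ TB ↔ s((Sum.inr j, 1), p (Sum.inr j, 1)) ∈ S := by simp [TB]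
  have hKL : K.card = L.card := by
    apply le_antisymm
    · refine Finset.card_le_card_of_forall_subsingleton
        (fun i j => M.Adj (Sum.inl i, 0) (Sum.inr j, 0)) ?_ ?_
      · intro i hi
        obtain ⟨j, hj⟩ := (nbrA i 0).resolve_right (memK.mp hi)
        exact ⟨j, memL.mpr (notVertB hj), hj⟩
      · rintro j - i ⟨-, hi⟩ i' ⟨-, hi'⟩
        simpa using uniq hi.symm hi'.symm
    · refine Finset.card_le_card_of_forall_subsingleton
        (fun j i => M.Adj (Sum.inl i, 0) (Sum.inr j, 0)) ?_ ?_
      · intro j hj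
        obtain ⟨i, hi⟩ := (nbrB j 0).resolve_right (memL.mp hj)
        exact ⟨i, memK.mpr (notVertA hi), hi⟩
      · rintro i - j ⟨-, hj⟩ j' ⟨-, hj'⟩
        simpa using uniq hj hj'
  have hK1 : (K \ TA).card ≤ 1 := by
    rw [Finset.card_le_one]
    intro i hi i' hi'
    rw [Finset.mem_sdiff, memTA] at hi hi'
    by_contra hne
    obtain ⟨j, hj⟩ := (nbrA i 0).resolve_right (memK.mp hi.1)
    obtain ⟨j', hj'⟩ := (nbrA i' 0).resolve_right (memK.mp hi'.1)
    rw [hpe hj] at hi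
    rw [hpe hj'] at hi'
    exact (cyc hj hj' (by simpa using hne) (by simp [boxProd_adj])
      (by simp [boxProd_adj])).elim hi.2 hi'.2
  have hL1 : (L \ TB).card ≤ 1 := by
    rw [Finset.card_le_one]
    intro j hj j' hj'
    rw [Finset.mem_sdiff, memTB] at hj hj'
    by_contra hne
    obtain ⟨i, hi⟩ := (nbrB j 1).resolve_right (memL.mp hj.1)
    obtain ⟨i', hi'⟩ := (nbrB j' 1).resolve_right (memL.mp hj'.1)
    rw [hpe hi.symm] at hj
    rw [hpe hi'.symm] at hj'
    exact (cyc hi.symm hi'.symm (by simpa using hne) (by simp [boxProd_adj])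
      (by simp [boxProd_adj])).elim hj.2 hj'.2
  have hone : K.card = 1 → 1 ≤ (K ∩ TA).card + (L ∩ TB).card := by
    intro h1
    obtain ⟨i, hKi⟩ := Finset.card_eq_one.mp h1
    obtain ⟨j, hLj⟩ := Finset.card_eq_one.mp (hKL ▸ h1)
    have hiK : i ∈ K := by simp [hKi]
    have hjL : j ∈ L := by simp [hLj]
    have edge : ∀ t, M.Adj (Sum.inl i, t) (Sum.inr j, t) := by
      intro t
      obtain ⟨j', hj'⟩ := (nbrA i t).resolve_right (memK.mp hiK)
      have hj'L : j' ∈ L := memL.mpr (notVertB hj')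
      rw [hLj, Finset.mem_singleton] at hj'L
      exact hj'L ▸ hj'
    rcases cyc (edge 0).symm (edge 1) (by simp) (by simp [boxProd_adj])
      (by simp [boxProd_adj]) with h | h
    · have : 0 < (K ∩ TA).card := Finset.card_pos.mpr
        ⟨i, Finset.mem_inter.mpr ⟨hiK, memTA.mpr (by rwa [hpe (edge 0), Sym2.eq_swap])⟩⟩
      omega
    · have : 0 < (L ∩ TB).card := Finset.card_pos.mpr
        ⟨j, Finset.mem_inter.mpr ⟨hjL, memTB.mpr (by rwa [hpe (edge 1).symm, Sym2.eq_swap])⟩⟩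
      omega
  have hvert : Kᶜ ⊆ TA ∨ Lᶜ ⊆ TB := by
    by_contra! h
    obtain ⟨⟨i, hi, hiT⟩, j, hj, hjT⟩ := And.intro (Finset.not_subset.mp h.1)
      (Finset.not_subset.mp h.2)
    rw [Finset.mem_compl, memK, not_not] at hi
    rw [Finset.mem_compl, memL, not_not] at hj
    rw [memTA, hpe hi] at hiT
    rw [memTB, hpe hj.symm] at hjT
    exact (cyc hi hj.symm (by simp) (by simp [boxProd_adj]) (by simp [boxProd_adj])).elim hiT hjT
  have hcount : TA.card + TB.card ≤ S.ncard := by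
    rw [← Finset.card_disjSum, ← Set.ncard_coe_finset]
    refine Set.ncard_le_ncard_of_injOn
      (Sum.elim (fun i => s((Sum.inl i, 0), p (Sum.inl i, 0)))
        (fun j => s((Sum.inr j, 1), p (Sum.inr j, 1)))) ?_ ?_ (Set.toFinite S)
    · rintro (i | j) h
      · exact memTA.mp (by simpa using h)
      · exact memTB.mp (by simpa using h)
    · have key : ∀ {x y}, ¬ M.Adj x y → s(x, p x) = s(y, p y) → x = y := by
        intro x y hxy h
        rcases Sym2.eq_iff.mp h with h | h
        · exact h.1
        · exact absurd (h.2 ▸ hp x) hxy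
      rintro (i | j) - (i' | j') - h
      · simpa using key (fun h => absurd h.adj_sub (by simp [boxProd_adj])) h
      · exact absurd (key (fun h => absurd h.adj_sub (by simp [boxProd_adj])) h) (by simp)
      · exact absurd (key (fun h => absurd h.adj_sub (by simp [boxProd_adj])) h) (by simp)
      · simpa using key (fun h => absurd h.adj_sub (by simp [boxProd_adj])) h
  have e1 := Finset.card_sdiff_add_card_inter K TA
  have e2 := Finset.card_sdiff_add_card_inter L TB
  have e3 : (K ∩ TA).card + (Kᶜ ∩ TA).card = TA.card := by
    rw [← Finset.card_union_of_disjoint, ← Finset.union_inter_distrib_right]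
    · simp
    · exact disjoint_compl_right.mono Finset.inter_subset_left Finset.inter_subset_left
  have e4 : (L ∩ TB).card + (Lᶜ ∩ TB).card = TB.card := by
    rw [← Finset.card_union_of_disjoint, ← Finset.union_inter_distrib_right]
    · simp
    · exact disjoint_compl_right.mono Finset.inter_subset_left Finset.inter_subset_left
  have e5 : K.card + Kᶜ.card = m := by simp
  have e6 : L.card + Lᶜ.card = n := by simp
  rcases hvert with h | h
  · rw [Finset.inter_eq_left.mpr h] at e3
    omega
  · rw [Finset.inter_eq_left.mpr h] at e4
    omega

theorem stmt18 (m n : ℕ) (hm : 1 ≤ m) (hn : 1 ≤ n) :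
    minForcingNumber (completeBipartiteGraph (Fin m) (Fin n) □ (⊤ : SimpleGraph (Fin 2)))
      = min m n := by
  apply le_antisymm
  · refine le_trans (b := forcingNumber _ (prismMatching _))
      (Nat.sInf_le ⟨_, prismMatching_isPerfectMatching _, rfl⟩) (le_min ?_ ?_)
    · refine forcingNumber_prismMatching_le _ Sum.inl Sum.inl_injective ?_
      rintro (v | v) (w | w) h <;> simp at h ⊢
    · refine forcingNumber_prismMatching_le _ Sum.inr Sum.inr_injective ?_
      rintro (v | v) (w | w) h <;> simp at h ⊢
  · unfold minForcingNumber
    refine le_csInf ⟨_, _, prismMatching_isPerfectMatching _, rfl⟩ ?_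
    rintro _ ⟨M, hM, rfl⟩
    unfold forcingNumber
    refine le_csInf ⟨_, M.edgeSet, subset_rfl, rfl, fun M' hM' h =>
      hM.eq_of_adj_imp hM' fun x y hxy => h (show s(x, y) ∈ M.edgeSet from hxy)⟩ ?_
    rintro _ ⟨S, hS, rfl, hforce⟩
    exact min_le_ncard_of_forcing hM hS hforce
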